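/- Let A be an n×n real matrix, r₀ ∈ ℝⁿ, and k ≥ 2. Then K_{k−1}(A, A r₀) ⊆ K_k(A, r₀); consequently, sup over nonzero z ∈ K_{k−1}(A, A r₀) of ‖A z‖/‖z‖ ≤ sup over nonzero z ∈ K_k(A, r₀) of ‖A z‖/‖z‖ and inf over nonzero z ∈ K_{k−1}(A, A r₀) of ‖A z‖/‖z‖ ≥ inf over nonzero z ∈ K_k(A, r₀) of ‖A z‖/‖z‖. Hence, if the latter infimum is positive, the condition number of the restriction of A to K_{k−1}(A, A r₀) is at most the condition number of the restriction of A to K_k(A, r₀); equivalently, for the Arnoldi Hessenberg matrices of RR-GMRES and GMRES, κ(H^R_{k,k−1}) ≤ κ(H_{k+1,k}). -/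

import Mathlib

open Matrix Submodule Module

/-- `matE M` : the linear map `EuclideanSpace ℝ (Fin k) → EuclideanSpace ℝ (Fin m)`
given by multiplication by the matrix `M`. -/
noncomputable def matE {m k : ℕ} (M : Matrix (Fin m) (Fin k) ℝ) :
    EuclideanSpace ℝ (Fin k) →ₗ[ℝ] EuclideanSpace ℝ (Fin m) :=
  Matrix.toEuclideanLin M

/-- The Krylov subspace K_k(A, r) = span {r, A r, …, A^{k-1} r}. -/
noncomputable def Krylov {n : ℕ} (A : Matrix (Fin n) (Fin n) ℝ)
    (r : EuclideanSpace ℝ (Fin n)) (k : ℕ) :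
    Submodule ℝ (EuclideanSpace ℝ (Fin n)) :=
  Submodule.span ℝ {v | ∃ i < k, v = (matE A ^ i) r}

/-- `supRatio M S` : the supremum of `‖M z‖ / ‖z‖` over nonzero `z ∈ S`. -/
noncomputable def supRatio {a b : ℕ} (M : Matrix (Fin a) (Fin b) ℝ)
    (S : Set (EuclideanSpace ℝ (Fin b))) : ℝ :=
  sSup ((fun z => ‖matE M z‖ / ‖z‖) '' {z ∈ S | z ≠ 0})

/-- `infRatio M S` : the infimum of `‖M z‖ / ‖z‖` over nonzero `z ∈ S`. -/
noncomputable def infRatio {a b : ℕ} (M : Matrix (Fin a) (Fin b) ℝ)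
    (S : Set (EuclideanSpace ℝ (Fin b))) : ℝ :=
  sInf ((fun z => ‖matE M z‖ / ‖z‖) '' {z ∈ S | z ≠ 0})

/-- The ratios `‖M z‖ / ‖z‖` are bounded above by the operator norm of `M`. -/
theorem bddAbove_image_ratio {a b : ℕ} (M : Matrix (Fin a) (Fin b) ℝ)
    (s : Set (EuclideanSpace ℝ (Fin b))) :
    BddAbove ((fun z => ‖matE M z‖ / ‖z‖) '' s) := by
  refine ⟨‖LinearMap.toContinuousLinearMap (matE M)‖, ?_⟩
  rintro _ ⟨z, -, rfl⟩
  exact (LinearMap.toContinuousLinearMap (matE M)).ratio_le_opNorm z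

theorem bddBelow_image_ratio {a b : ℕ} (M : Matrix (Fin a) (Fin b) ℝ)
    (s : Set (EuclideanSpace ℝ (Fin b))) :
    BddBelow ((fun z => ‖matE M z‖ / ‖z‖) '' s) := by
  refine ⟨0, ?_⟩
  rintro _ ⟨z, -, rfl⟩
  positivity

theorem supRatio_nonneg {a b : ℕ} (M : Matrix (Fin a) (Fin b) ℝ)
    (S : Set (EuclideanSpace ℝ (Fin b))) : 0 ≤ supRatio M S := by
  refine Real.sSup_nonneg ?_
  rintro _ ⟨z, -, rfl⟩
  positivity

theorem supRatio_mono {a b : ℕ} (M : Matrix (Fin a) (Fin b) ℝ)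
    {S T : Set (EuclideanSpace ℝ (Fin b))} (h : S ⊆ T) : supRatio M S ≤ supRatio M T := by
  rcases Set.eq_empty_or_nonempty {z ∈ S | z ≠ 0} with hS | hS
  · have hzero : supRatio M S = 0 := by simp only [supRatio, hS, Set.image_empty, Real.sSup_empty]
    exact hzero ▸ supRatio_nonneg M T
  · exact csSup_le_csSup (bddAbove_image_ratio M _) (hS.image _)
      (Set.image_mono fun _ hz => ⟨h hz.1, hz.2⟩)

theorem infRatio_anti {a b : ℕ} (M : Matrix (Fin a) (Fin b) ℝ)
    {S T : Set (EuclideanSpace ℝ (Fin b))} (h : S ⊆ T) (hS : {z ∈ S | z ≠ 0}.Nonempty) :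
    infRatio M T ≤ infRatio M S :=
  csInf_le_csInf (bddBelow_image_ratio M _) (hS.image _)
    (Set.image_mono fun _ hz => ⟨h hz.1, hz.2⟩)

theorem infRatio_nonpos {a b : ℕ} (M : Matrix (Fin a) (Fin b) ℝ)
    {S : Set (EuclideanSpace ℝ (Fin b))} {v : EuclideanSpace ℝ (Fin b)} (hv : v ∈ S)
    (hv0 : v ≠ 0) (hM : matE M v = 0) : infRatio M S ≤ 0 :=
  csInf_le (bddBelow_image_ratio M _) ⟨v, ⟨hv, hv0⟩, by simp [hM]⟩

theorem infRatio_bot {a b : ℕ} (M : Matrix (Fin a) (Fin b) ℝ) :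
    infRatio M ((⊥ : Submodule ℝ (EuclideanSpace ℝ (Fin b))) : Set _) = 0 := by
  have hempty : {z : EuclideanSpace ℝ (Fin b) | z ∈ (⊥ : Submodule ℝ _) ∧ z ≠ 0} = ∅ := by
    ext z
    simp
  simp only [infRatio, SetLike.mem_coe, hempty, Set.image_empty, Real.sInf_empty]

theorem mem_krylov {n k : ℕ} (A : Matrix (Fin n) (Fin n) ℝ) (r : EuclideanSpace ℝ (Fin n))
    (hk : 0 < k) : r ∈ Krylov A r k :=
  Submodule.subset_span ⟨0, hk, by simp⟩

theorem krylov_zero {n : ℕ} (A : Matrix (Fin n) (Fin n) ℝ) (k : ℕ) : Krylov A 0 k = ⊥ := by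
  rw [Krylov, Submodule.span_eq_bot]
  rintro _ ⟨i, -, rfl⟩
  exact map_zero _

theorem krylov_apply_le {n k : ℕ} (A : Matrix (Fin n) (Fin n) ℝ)
    (r : EuclideanSpace ℝ (Fin n)) : Krylov A (matE A r) (k - 1) ≤ Krylov A r k := by
  refine Submodule.span_mono ?_
  rintro _ ⟨i, hi, rfl⟩
  exact ⟨i + 1, by omega, by rw [pow_succ]; rfl⟩

theorem infRatio_krylov_le {n k : ℕ} (hk : 2 ≤ k) (A : Matrix (Fin n) (Fin n) ℝ)
    (r : EuclideanSpace ℝ (Fin n)) :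
    infRatio A (Krylov A r k : Set _) ≤ infRatio A (Krylov A (matE A r) (k - 1) : Set _) := by
  by_cases hAr : matE A r = 0
  · rw [hAr, krylov_zero, infRatio_bot]
    by_cases hr : r = 0
    · rw [hr, krylov_zero, infRatio_bot]
    · exact infRatio_nonpos A (mem_krylov A r (by omega)) hr hAr
  · exact infRatio_anti A (krylov_apply_le A r)
      ⟨matE A r, mem_krylov A (matE A r) (by omega), hAr⟩

/-- For `k ≥ 2`, the range-restricted Krylov subspace satisfies
`K_{k−1}(A, A r₀) ⊆ K_k(A, r₀)`; consequently the extremal ratios of `A` on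
`K_{k−1}(A, A r₀)` are sandwiched by those on `K_k(A, r₀)`, and if the infimum over
`K_k(A, r₀)` is positive, then the condition number of the restriction of `A` to
`K_{k−1}(A, A r₀)` is at most that of the restriction of `A` to `K_k(A, r₀)`
(i.e. `κ(H^R_{k,k−1}) ≤ κ(H_{k+1,k})`). -/
theorem rr_krylov_better_conditioned {n k : ℕ} (hk : 2 ≤ k)
    (A : Matrix (Fin n) (Fin n) ℝ) (r₀ : EuclideanSpace ℝ (Fin n)) :
    Krylov A (matE A r₀) (k - 1) ≤ Krylov A r₀ k ∧
    supRatio A (Krylov A (matE A r₀) (k - 1) : Set _) ≤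
      supRatio A (Krylov A r₀ k : Set _) ∧
    infRatio A (Krylov A r₀ k : Set _) ≤
      infRatio A (Krylov A (matE A r₀) (k - 1) : Set _) ∧
    (0 < infRatio A (Krylov A r₀ k : Set _) →
      supRatio A (Krylov A (matE A r₀) (k - 1) : Set _) /
          infRatio A (Krylov A (matE A r₀) (k - 1) : Set _) ≤
        supRatio A (Krylov A r₀ k : Set _) /
          infRatio A (Krylov A r₀ k : Set _)) := by
  have hsup := supRatio_mono A (krylov_apply_le (k := k) A r₀)
  have hinf := infRatio_krylov_le hk A r₀
  exact ⟨krylov_apply_le A r₀, hsup, hinf,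
    fun hpos => div_le_div₀ (supRatio_nonneg A _) hsup hpos hinf⟩
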